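/- Let X be a real separable Banach space and let γ be a centred nondegenerate Gaussian probability measure on X (the pushforward of γ under every continuous linear functional f is a centred Gaussian measure on ℝ, which is not a Dirac mass when f ≠ 0). Let Ω ⊆ X be a nonempty open convex set. Then there exist a sequence of dimensions (k_n), continuous linear maps Π_n : X → ℝ^{k_n}, and open convex sets 𝒪_n ⊆ ℝ^{k_n} whose boundaries are of class C^∞, such that the cylindrical sets Ω_n := Π_n^{-1}(𝒪_n) are open convex, satisfy Ω ⊆ Ω_{n+1} ⊆ Ω_n for all n, and γ(Ω_n \ Ω) → 0 as n → ∞. (Final proposition of the Appendix: approximation of an open convex set by cylindrical convex sets with smooth boundaries.) -/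

import Mathlib

open Set Filter MeasureTheory ProbabilityTheory

/-- The boundary of `S ⊆ ℝ^k` is of class `C^∞`: near every boundary point, the boundary is the
zero level set of a smooth function with nonvanishing gradient on the boundary. -/
def HasSmoothBoundary {k : ℕ} (S : Set (EuclideanSpace ℝ (Fin k))) : Prop :=
  ∀ p ∈ frontier S, ∃ U : Set (EuclideanSpace ℝ (Fin k)), IsOpen U ∧ p ∈ U ∧
    ∃ f : EuclideanSpace ℝ (Fin k) → ℝ, ContDiff ℝ (⊤ : ℕ∞) f ∧
      frontier S ∩ U = {x ∈ U | f x = 0} ∧ ∀ x ∈ frontier S ∩ U, gradient f x ≠ 0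

open scoped Topology ENNReal

/-- Smooth convex function vanishing exactly on the nonpositive reals. -/
noncomputable def cylPhi (t : ℝ) : ℝ := ∫ s in (0 : ℝ)..t, expNegInvGlue s

lemma cylPhi_hasDerivAt (t : ℝ) : HasDerivAt cylPhi (expNegInvGlue t) t := by
  have hc : Continuous expNegInvGlue := (expNegInvGlue.contDiff (n := 0)).continuous
  exact intervalIntegral.integral_hasDerivAt_right (hc.intervalIntegrable _ _)
    (hc.stronglyMeasurableAtFilter _ _) hc.continuousAt

lemma cylPhi_deriv : deriv cylPhi = expNegInvGlue :=
  funext fun t => (cylPhi_hasDerivAt t).deriv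

lemma cylPhi_contDiff : ContDiff ℝ (⊤ : ℕ∞) cylPhi := by
  rw [contDiff_infty_iff_deriv, cylPhi_deriv]
  exact ⟨fun t => (cylPhi_hasDerivAt t).differentiableAt, expNegInvGlue.contDiff⟩

lemma cylPhi_convexOn : ConvexOn ℝ univ cylPhi := by
  apply Monotone.convexOn_univ_of_deriv (fun t => (cylPhi_hasDerivAt t).differentiableAt)
  rw [cylPhi_deriv]
  exact expNegInvGlue.monotone

lemma cylPhi_of_nonpos {t : ℝ} (ht : t ≤ 0) : cylPhi t = 0 := by
  unfold cylPhi
  rw [intervalIntegral.integral_congr (g := fun _ => (0 : ℝ))]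
  · simp
  · intro s hs
    rw [uIcc_of_ge ht] at hs
    exact expNegInvGlue.zero_of_nonpos hs.2

lemma cylPhi_pos {t : ℝ} (ht : 0 < t) : 0 < cylPhi t := by
  have hc : Continuous expNegInvGlue := (expNegInvGlue.contDiff (n := 0)).continuous
  exact intervalIntegral.intervalIntegral_pos_of_pos_on (hc.intervalIntegrable _ _)
    (fun s hs => expNegInvGlue.pos_of_pos hs.1) ht

lemma cylPhi_nonneg (t : ℝ) : 0 ≤ cylPhi t := by
  rcases le_or_gt t 0 with h | h
  · exact (cylPhi_of_nonpos h).ge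
  · exact (cylPhi_pos h).le

/-- The finite sum used to define the approximating sets. -/
noncomputable def cylG {n : ℕ} (c : Fin n → ℝ) (y : EuclideanSpace ℝ (Fin n)) : ℝ :=
  ∑ i, cylPhi (y i - c i)

lemma cylG_contDiff {n : ℕ} (c : Fin n → ℝ) : ContDiff ℝ (⊤ : ℕ∞) (cylG c) := by
  unfold cylG
  apply ContDiff.sum
  intro i _
  apply cylPhi_contDiff.comp
  fun_prop

lemma cylG_convexOn {n : ℕ} (c : Fin n → ℝ) : ConvexOn ℝ univ (cylG c) := by
  refine ⟨convex_univ, fun x _ y _ a b ha hb hab => ?_⟩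
  unfold cylG
  rw [Finset.smul_sum, Finset.smul_sum, ← Finset.sum_add_distrib]
  apply Finset.sum_le_sum
  intro i _
  have := cylPhi_convexOn.2 (mem_univ (x i - c i)) (mem_univ (y i - c i)) ha hb hab
  convert this using 2
  simp
  linear_combination (c i) * hab

lemma cyl_smooth_convex {n : ℕ} (c : Fin n → ℝ) {ε : ℝ} (hε : 0 < ε) :
    IsOpen {y | cylG c y < ε} ∧ Convex ℝ {y | cylG c y < ε} ∧
      HasSmoothBoundary {y | cylG c y < ε} := by
  have hcont : Continuous (cylG c) := (cylG_contDiff c).continuous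
  have hconv := cylG_convexOn c
  refine ⟨isOpen_lt hcont continuous_const, by simpa using hconv.convex_lt ε, ?_⟩
  obtain ⟨a, ha⟩ : ∃ a, cylG c a = 0 := by
    refine ⟨WithLp.toLp 2 c, ?_⟩
    simp [cylG, cylPhi_of_nonpos]
  have hseg : ∀ x, cylG c x = ε → ∀ t : ℝ, 0 ≤ t → t ≤ 1 →
      cylG c (x + t • (a - x)) ≤ (1 - t) * ε := by
    intro x hx t h0 h1
    have := hconv.2 (mem_univ x) (mem_univ a) (sub_nonneg.2 h1) h0 (by ring)
    rw [ha, hx] at this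
    have e : x + t • (a - x) = (1 - t) • x + t • a := by module
    rw [e]
    simpa using this
  have hfr : frontier {y | cylG c y < ε} = {y | cylG c y = ε} := by
    apply Subset.antisymm
    · exact frontier_lt_subset_eq hcont continuous_const
    · intro x hx
      have hx' : cylG c x = ε := hx
      rw [(isOpen_lt hcont continuous_const).frontier_eq]
      refine ⟨?_, fun h => absurd hx' (ne_of_lt h)⟩
      have hl : Tendsto (fun t : ℝ => x + t • (a - x)) (𝓝[>] 0) (𝓝 x) := by
        have : ContinuousAt (fun t : ℝ => x + t • (a - x)) 0 := by fun_prop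
        have h2 := this.tendsto
        simp only [zero_smul, add_zero] at h2
        exact h2.mono_left nhdsWithin_le_nhds
      apply mem_closure_of_tendsto hl
      filter_upwards [Ioc_mem_nhdsGT (show (0 : ℝ) < 1 by norm_num)] with t ht
      have := hseg x hx' t ht.1.le ht.2
      show _ < ε
      nlinarith [ht.1]
  intro p hp
  refine ⟨univ, isOpen_univ, mem_univ _, fun y => cylG c y - ε,
    (cylG_contDiff c).sub contDiff_const, ?_, ?_⟩
  · rw [hfr]; ext x; simp [sub_eq_zero]
  · intro x hx hgrad
    rw [hfr] at hx
    have hx' : cylG c x = ε := hx.1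
    have hdiff : DifferentiableAt ℝ (fun y => cylG c y - ε) x :=
      (((cylG_contDiff c).sub contDiff_const).differentiable (by simp)) x
    have hg := hdiff.hasGradientAt
    rw [hgrad] at hg
    have hf : HasFDerivAt (fun y => cylG c y - ε) (0 : EuclideanSpace ℝ (Fin n) →L[ℝ] ℝ) x := by
      simpa using hg.hasFDerivAt
    have hline : HasDerivAt (fun t : ℝ => x + t • (a - x)) (a - x) 0 := by
      simpa using ((hasDerivAt_id (0 : ℝ)).smul_const (a - x)).const_add x
    have hcomp : HasDerivAt (fun t : ℝ => cylG c (x + t • (a - x)) - ε) 0 0 := by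
      have hf' : HasFDerivAt (fun y => cylG c y - ε) (0 : EuclideanSpace ℝ (Fin n) →L[ℝ] ℝ)
        (x + (0 : ℝ) • (a - x)) := by simpa using hf
      have hh := hf'.comp_hasDerivAt (0 : ℝ) hline
      rw [zero_apply] at hh
      exact hh
    have hslope := hcomp.tendsto_slope_zero_right
    have hle : (0 : ℝ) ≤ -ε := by
      apply le_of_tendsto hslope
      filter_upwards [Ioc_mem_nhdsGT (show (0 : ℝ) < 1 by norm_num)] with t ht
      have := hseg x hx' t ht.1.le ht.2
      simp only [zero_add, zero_smul, add_zero, hx', sub_self, sub_zero, smul_eq_mul]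
      rw [inv_mul_le_iff₀ ht.1]
      nlinarith
    linarith

section Gaussian

variable {X : Type*}
    [NormedAddCommGroup X] [NormedSpace ℝ X] [CompleteSpace X]
    [TopologicalSpace.SeparableSpace X] [MeasurableSpace X] [BorelSpace X]

/-- Directions of the Cameron-Martin space coming from functionals. -/
noncomputable def cylDir (γ : Measure X) (f : X →L[ℝ] ℝ) : X := ∫ x, f x • x ∂γ

lemma cyl_memLp (γ : Measure X) [IsGaussian γ] (f : X →L[ℝ] ℝ) :
    MemLp (fun x => f x) 2 γ := IsGaussian.memLp_dual γ f 2 (by simp)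

lemma cyl_integrable (γ : Measure X) [IsGaussian γ] (f : X →L[ℝ] ℝ) :
    Integrable (fun x => f x • x) γ := by
  have : SecondCountableTopology X := UniformSpace.secondCountable_of_separable X
  have h2 : MemLp (id : X → X) 2 γ := IsGaussian.memLp_two_id
  exact memLp_one_iff_integrable.1 (h2.smul (cyl_memLp γ f) (r := 1))

lemma cylDir_apply (γ : Measure X) [IsGaussian γ] (f g : X →L[ℝ] ℝ) :
    g (cylDir γ f) = ∫ x, f x * g x ∂γ := by
  unfold cylDir
  rw [← g.integral_comp_comm (cyl_integrable γ f)]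
  simp

lemma cylDir_convex (γ : Measure X) [IsGaussian γ] : Convex ℝ (range (cylDir γ)) := by
  rintro _ ⟨f, rfl⟩ _ ⟨g, rfl⟩ a b _ _ _
  refine ⟨a • f + b • g, ?_⟩
  unfold cylDir
  rw [← integral_smul, ← integral_smul,
    ← integral_add (f := fun x => a • f x • x) (g := fun x => b • g x • x)
      ((cyl_integrable γ f).smul a) ((cyl_integrable γ g).smul b)]
  congr 1
  ext x
  simp [add_smul, mul_smul]

lemma cyl_var (γ : Measure X) [IsProbabilityMeasure γ] (f : X →L[ℝ] ℝ) (v : NNReal)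
    (h : γ.map (fun x => f x) = gaussianReal 0 v) : ∫ x, f x * f x ∂γ = v := by
  have h1 : ∫ y, y ^ 2 ∂(gaussianReal 0 v) = v := by
    have h2 := variance_id_gaussianReal (μ := 0) (v := v)
    rw [variance_eq_sub (memLp_id_gaussianReal' 2 (by simp))] at h2
    simpa using h2
  rw [← h, integral_map (by fun_prop) (by fun_prop)] at h1
  simpa [sq] using h1

lemma cyl_mean (γ : Measure X) [IsProbabilityMeasure γ] (f : X →L[ℝ] ℝ) (v : NNReal)
    (h : γ.map (fun x => f x) = gaussianReal 0 v) : ∫ x, f x ∂γ = 0 := by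
  have h1 : ∫ y, y ∂(gaussianReal 0 v) = 0 := by simp
  rw [← h, integral_map (by fun_prop) (by fun_prop)] at h1
  exact h1

lemma cyl_line_null (γ : Measure X) [IsProbabilityMeasure γ] [IsGaussian γ]
    (hmean : ∀ f : X →L[ℝ] ℝ, ∫ x, f x ∂γ = 0)
    (f : X →L[ℝ] ℝ) (v : NNReal) (hv : v ≠ 0)
    (hf : γ.map (fun x => f x) = gaussianReal 0 v)
    (A : Set X) (hA : MeasurableSet A)
    (hsub : ∀ x, {t : ℝ | x + t • cylDir γ f ∈ A}.Subsingleton) : γ A = 0 := by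
  have : SecondCountableTopology X := UniformSpace.secondCountable_of_separable X
  set h := cylDir γ f with hh
  have hvR : (v : ℝ) ≠ 0 := by exact_mod_cast hv
  let Y : X →L[ℝ] X := ContinuousLinearMap.id ℝ X - (f.smulRight ((v : ℝ)⁻¹ • h))
  have hlaw : HasGaussianLaw (fun x => (f x, Y x)) γ := by
    have := (IsGaussian.hasGaussianLaw_id (μ := γ)).map (f.prod Y)
    exact this
  have hind : IndepFun (fun x => f x) (fun x => Y x) γ := by
    apply hlaw.indepFun_of_covariance_strongDual
    intro L₁ L₂
    have e1 : (L₁ ∘ fun x => f x) = fun x => (L₁ ∘L f) x := rfl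
    have e2 : (L₂ ∘ fun x => Y x) = fun x => (L₂ ∘L Y) x := rfl
    rw [e1, e2, covariance_eq_sub (cyl_memLp γ _) (cyl_memLp γ _), hmean, zero_mul, sub_zero]
    have e3 : (∫ x, ((fun x => (L₁ ∘L f) x) * fun x => (L₂ ∘L Y) x) x ∂γ)
        = ∫ x, (L₁ ∘L f) x * (L₂ ∘L Y) x ∂γ := rfl
    have e4 : ∀ x, (L₁ ∘L f) x * (L₂ ∘L Y) x
        = L₁ 1 * (f x * (L₂ ∘L Y) x) := by
      intro x
      have : L₁ (f x) = f x * L₁ 1 := by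
        rw [← smul_eq_mul, ← L₁.map_smul]; simp
      simp only [ContinuousLinearMap.comp_apply, this]; ring
    rw [e3]
    simp_rw [e4]
    rw [integral_const_mul, ← cylDir_apply, ContinuousLinearMap.comp_apply]
    have : Y (cylDir γ f) = 0 := by
      have h1 : f (cylDir γ f) = v := by rw [cylDir_apply, cyl_var γ f v hf]
      simp [Y, h1, hh, smul_smul, hvR]
    simp [this]
  have hprod := hind.map_prod_eq_prod_map_map (by fun_prop) (by fun_prop)
  have hAeq : γ A = (γ.map (fun x => (f x, Y x)))
      {p : ℝ × X | p.2 + (p.1 * (v : ℝ)⁻¹) • h ∈ A} := by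
    rw [Measure.map_apply (by fun_prop)]
    · congr 1
      ext x
      simp [Y, smul_smul]
    · exact (by fun_prop : Measurable fun p : ℝ × X => p.2 + (p.1 * (v : ℝ)⁻¹) • h) hA
  have hm : MeasurableSet {p : ℝ × X | p.2 + (p.1 * (v : ℝ)⁻¹) • h ∈ A} :=
    (by fun_prop : Measurable fun p : ℝ × X => p.2 + (p.1 * (v : ℝ)⁻¹) • h) hA
  rw [hAeq, hprod, hf]
  have := nullSingletonClass_gaussianReal (μ := 0) hv
  have : IsProbabilityMeasure (γ.map fun x => Y x) :=
    Measure.isProbabilityMeasure_map (by fun_prop)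
  rw [Measure.prod_apply_symm hm]
  rw [lintegral_eq_zero_of_ae_eq_zero]
  refine Eventually.of_forall fun y => ?_
  apply Set.Subsingleton.measure_zero
  intro s hs t ht
  have := hsub y (show s * (v : ℝ)⁻¹ ∈ _ from hs) (show t * (v : ℝ)⁻¹ ∈ _ from ht)
  exact mul_right_cancel₀ (inv_ne_zero hvR) this

lemma cyl_frontier_null (γ : Measure X) [IsProbabilityMeasure γ]
    (hgauss : ∀ f : X →L[ℝ] ℝ, ∃ v : NNReal,
      γ.map (fun x => f x) = gaussianReal 0 v ∧ (f ≠ 0 → v ≠ 0))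
    (Ω : Set X) (hΩo : IsOpen Ω) (hΩc : Convex ℝ Ω) (hΩn : Ω.Nonempty) :
    γ (frontier Ω) = 0 := by
  have : SecondCountableTopology X := UniformSpace.secondCountable_of_separable X
  have : IsGaussian γ := isGaussian_of_map_eq_gaussianReal fun L => by
    obtain ⟨v, hv, _⟩ := hgauss L
    exact ⟨0, v, hv⟩
  have hmean : ∀ f : X →L[ℝ] ℝ, ∫ x, f x ∂γ = 0 := fun f => by
    obtain ⟨v, hv, _⟩ := hgauss f
    exact cyl_mean γ f v hv
  let S : (X →L[ℝ] ℝ) → Set X := fun f => (fun x => x + cylDir γ f) ⁻¹' Ω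
  have hSo : ∀ f, IsOpen (S f) := fun f => hΩo.preimage (by fun_prop)
  have hcover : ∀ x : X, ∃ f, x ∈ S f := by
    intro x
    by_contra hcon
    push Not at hcon
    have hdisj : Disjoint ((fun z => x + z) ⁻¹' Ω) (range (cylDir γ)) := by
      rw [Set.disjoint_right]
      rintro _ ⟨f, rfl⟩ hf
      exact hcon f hf
    obtain ⟨L, u, hL1, hL2⟩ := geometric_hahn_banach_open
      (hΩc.translate_preimage_right x) (hΩo.preimage (by fun_prop)) (cylDir_convex γ) hdisj
    obtain ⟨v, hv, hv0⟩ := hgauss L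
    have hLL := cyl_var γ L v hv
    obtain ⟨w, hw⟩ := hΩn
    have hwu := hL1 (w - x) (by simpa using hw)
    by_cases hL0 : L = 0
    · have := hL2 (cylDir γ 0) ⟨0, rfl⟩
      simp only [hL0, zero_apply] at this hwu
      linarith
    · have hvpos : (0 : ℝ) < v := by
        have := hv0 hL0
        exact_mod_cast pos_iff_ne_zero.2 this
      have := hL2 (cylDir γ (((u - 1) / v) • L)) ⟨_, rfl⟩
      rw [cylDir_apply] at this
      have e : (∫ y, (((u - 1) / (v : ℝ)) • L) y * L y ∂γ) = u - 1 := by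
        have : ∀ y, (((u - 1) / (v : ℝ)) • L) y * L y = ((u - 1) / (v : ℝ)) * (L y * L y) := by
          intro y; simp; ring
        simp_rw [this]
        rw [integral_const_mul, hLL]
        field_simp
      linarith
  obtain ⟨T, hTc, hT⟩ := TopologicalSpace.isOpen_iUnion_countable S hSo
  have hsub : frontier Ω ⊆ ⋃ f ∈ T, (frontier Ω ∩ S f) := by
    intro x hx
    have : x ∈ ⋃ f ∈ T, S f := by
      rw [hT]; exact mem_iUnion.2 (hcover x)
    simp only [mem_iUnion] at this ⊢
    obtain ⟨f, hf, hxf⟩ := this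
    exact ⟨f, hf, hx, hxf⟩
  refine measure_mono_null hsub ((measure_biUnion_null_iff hTc).2 fun f _ => ?_)
  have hfrontier : ∀ x ∈ frontier Ω, x ∈ closure Ω ∧ x ∉ Ω := by
    intro x hx
    rw [hΩo.frontier_eq] at hx
    exact hx
  by_cases hf0 : f = 0
  · have : frontier Ω ∩ S f = ∅ := by
      ext x
      simp only [mem_inter_iff, mem_empty_iff_false, iff_false, not_and]
      intro hx hxs
      have h0 : cylDir γ f = 0 := by simp [cylDir, hf0]
      simp only [S, mem_preimage, h0, add_zero] at hxs
      exact (hfrontier x hx).2 hxs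
    rw [this, measure_empty]
  · obtain ⟨v, hv, hv0⟩ := hgauss f
    refine cyl_line_null γ hmean f v (hv0 hf0) hv _
      (isClosed_frontier.measurableSet.inter (hSo f).measurableSet) ?_
    intro x
    have key : ∀ s t : ℝ, s < t → x + s • cylDir γ f ∈ frontier Ω ∩ S f →
        x + t • cylDir γ f ∈ frontier Ω ∩ S f → False := by
      intro s t hst hs ht
      set h := cylDir γ f
      -- the point at parameter `t` lies strictly between `s` and `t + 1`
      have h1 : x + t • h + h ∈ interior Ω := by
        rw [hΩo.interior_eq]; exact ht.2
      have h2 : x + s • h ∈ closure Ω := (hfrontier _ hs.1).1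
      have h3 := hΩc.openSegment_interior_closure_subset_interior h1 h2
      have hpos : 0 < t - s := sub_pos.2 hst
      have hmem : x + t • h ∈ openSegment ℝ (x + t • h + h) (x + s • h) := by
        refine ⟨(t - s) / (t - s + 1), 1 / (t - s + 1), by positivity, by positivity, by
          field_simp, ?_⟩
        have hne : t - s + 1 ≠ 0 := by positivity
        have e1 : (t - s) / (t - s + 1) + 1 / (t - s + 1) = 1 := by field_simp
        have e2 : (t - s) / (t - s + 1) * (t + 1) + 1 / (t - s + 1) * s = t := by
          field_simp; ring
        calc _ = ((t - s) / (t - s + 1) + 1 / (t - s + 1)) • x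
              + ((t - s) / (t - s + 1) * (t + 1) + 1 / (t - s + 1) * s) • h := by module
          _ = _ := by rw [e1, e2, one_smul]
      have := h3 hmem
      rw [hΩo.interior_eq] at this
      exact (hfrontier _ ht.1).2 this
    intro s hs t ht
    rcases lt_trichotomy s t with h | h | h
    · exact (key s t h hs ht).elim
    · exact h
    · exact (key t s h ht hs).elim

lemma cyl_halfspaces (Ω : Set X) (hΩc : Convex ℝ Ω) :
    ∃ (f : ℕ → X →L[ℝ] ℝ) (c : ℕ → ℝ), (∀ i, ∀ x ∈ Ω, f i x < c i) ∧
      ∀ x, (∀ i, f i x ≤ c i) → x ∈ closure Ω := by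
  have : SecondCountableTopology X := UniformSpace.secondCountable_of_separable X
  let I := {p : (X →L[ℝ] ℝ) × ℝ // ∀ x ∈ Ω, p.1 x < p.2}
  let U : I → Set X := fun p => {x | p.1.2 < p.1.1 x}
  obtain ⟨T, hTc, hT⟩ := TopologicalSpace.isOpen_iUnion_countable U
    (fun p => isOpen_lt continuous_const p.1.1.continuous)
  let p0 : I := ⟨(0, 1), fun x _ => by simp⟩
  obtain ⟨g, hg⟩ := (hTc.insert p0).exists_eq_range (insert_nonempty _ _)
  refine ⟨fun i => (g i).1.1, fun i => (g i).1.2, fun i => (g i).2, fun x hx => ?_⟩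
  by_contra hcl
  obtain ⟨L, u, hL, hu⟩ := geometric_hahn_banach_closed_point hΩc.closure isClosed_closure hcl
  have : x ∈ ⋃ p, U p :=
    mem_iUnion.2 ⟨⟨(L, u), fun y hy => hL y (subset_closure hy)⟩, hu⟩
  rw [← hT] at this
  simp only [mem_iUnion] at this
  obtain ⟨p, hp, hxp⟩ := this
  have hpr : p ∈ range g := hg ▸ mem_insert_of_mem _ hp
  obtain ⟨i, rfl⟩ := hpr
  exact absurd (hx i) (not_le.2 hxp)

end Gaussian

theorem cylindrical_smooth_approximation_of_convex {X : Type*}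
    [NormedAddCommGroup X] [NormedSpace ℝ X] [CompleteSpace X]
    [TopologicalSpace.SeparableSpace X] [MeasurableSpace X] [BorelSpace X]
    (γ : Measure X) [IsProbabilityMeasure γ]
    (hgauss : ∀ f : X →L[ℝ] ℝ, ∃ v : NNReal,
      γ.map (fun x => f x) = gaussianReal 0 v ∧ (f ≠ 0 → v ≠ 0))
    (Ω : Set X) (hΩo : IsOpen Ω) (hΩc : Convex ℝ Ω) (hΩn : Ω.Nonempty) :
    ∃ (k : ℕ → ℕ) (P : ∀ n : ℕ, X →L[ℝ] EuclideanSpace ℝ (Fin (k n)))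
      (O : ∀ n : ℕ, Set (EuclideanSpace ℝ (Fin (k n)))),
      (∀ n, IsOpen (O n) ∧ Convex ℝ (O n) ∧ HasSmoothBoundary (O n)) ∧
      (∀ n, IsOpen ((P n) ⁻¹' (O n)) ∧ Convex ℝ ((P n) ⁻¹' (O n))) ∧
      (∀ n, Ω ⊆ (P n) ⁻¹' (O n) ∧ (P (n + 1)) ⁻¹' (O (n + 1)) ⊆ (P n) ⁻¹' (O n)) ∧
      Tendsto (fun n => γ ((P n) ⁻¹' (O n) \ Ω)) atTop (nhds 0) := by
  have hfr := cyl_frontier_null γ hgauss Ω hΩo hΩc hΩn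
  obtain ⟨f, c, hlt, hcl⟩ := cyl_halfspaces Ω hΩc
  let P : ∀ n : ℕ, X →L[ℝ] EuclideanSpace ℝ (Fin n) := fun n =>
    (EuclideanSpace.equiv (Fin n) ℝ).symm.toContinuousLinearMap ∘L
      ContinuousLinearMap.pi (fun i : Fin n => f i)
  have hP : ∀ n x (i : Fin n), P n x i = f i x := fun n x i => rfl
  let ε : ℕ → ℝ := fun n => 1 / ((n : ℝ) + 1)
  have hε : ∀ n, 0 < ε n := fun n => by positivity
  let O : ∀ n : ℕ, Set (EuclideanSpace ℝ (Fin n)) := fun n =>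
    {y | cylG (fun i : Fin n => c i) y < ε n}
  have hO : ∀ n, IsOpen (O n) ∧ Convex ℝ (O n) ∧ HasSmoothBoundary (O n) := fun n =>
    cyl_smooth_convex _ (hε n)
  have hmem : ∀ n x, x ∈ (P n) ⁻¹' (O n) ↔
      ∑ i ∈ Finset.range n, cylPhi (f i x - c i) < ε n := by
    intro n x
    rw [Finset.sum_range]
    rfl
  have hanti : ∀ n, (P (n + 1)) ⁻¹' (O (n + 1)) ⊆ (P n) ⁻¹' (O n) := by
    intro n x hx
    rw [hmem] at hx ⊢
    rw [Finset.sum_range_succ] at hx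
    have h1 : ε (n + 1) ≤ ε n := by
      have := one_div_le_one_div_of_le (show (0 : ℝ) < (n : ℝ) + 1 by positivity)
        (show (n : ℝ) + 1 ≤ ((n + 1 : ℕ) : ℝ) + 1 by push_cast; linarith)
      exact this
    have := cylPhi_nonneg (f n x - c n)
    linarith
  have hopen : ∀ n, IsOpen ((P n) ⁻¹' (O n)) := fun n => (hO n).1.preimage (P n).continuous
  refine ⟨fun n => n, P, O, hO,
    fun n => ⟨hopen n, (hO n).2.1.linear_preimage (P n).toLinearMap⟩,
    fun n => ⟨?_, hanti n⟩, ?_⟩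
  · intro x hx
    rw [hmem, Finset.sum_eq_zero]
    · exact hε n
    · intro i _
      exact cylPhi_of_nonpos (by linarith [hlt i x hx])
  · have hant : Antitone fun n => (P n) ⁻¹' (O n) \ Ω :=
      antitone_nat_of_succ_le fun n => sdiff_subset_sdiff_left (hanti n)
    have ht := tendsto_measure_iInter_atTop (μ := γ) (s := fun n => (P n) ⁻¹' (O n) \ Ω)
      (fun n => ((hopen n).measurableSet.diff hΩo.measurableSet).nullMeasurableSet) hant
      ⟨0, measure_ne_top _ _⟩
    have hz : γ (⋂ n, (P n) ⁻¹' (O n) \ Ω) = 0 := by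
      refine measure_mono_null ?_ hfr
      intro x hx
      rw [mem_iInter] at hx
      rw [hΩo.frontier_eq]
      refine ⟨hcl x fun i => ?_, (hx 0).2⟩
      by_contra hi
      have hpos : 0 < cylPhi (f i x - c i) := cylPhi_pos (by linarith)
      obtain ⟨N, hN⟩ := exists_nat_one_div_lt hpos
      have hx2 := (hmem (max N (i + 1)) x).1 (hx _).1
      have h3 : cylPhi (f i x - c i) ≤
          ∑ j ∈ Finset.range (max N (i + 1)), cylPhi (f j x - c j) :=
        Finset.single_le_sum (f := fun j => cylPhi (f j x - c j))
          (fun j _ => cylPhi_nonneg _) (by simp)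
      have h4 : ε (max N (i + 1)) ≤ 1 / ((N : ℝ) + 1) := by
        apply one_div_le_one_div_of_le (by positivity)
        have : (N : ℝ) ≤ ((max N (i + 1) : ℕ) : ℝ) := by exact_mod_cast le_max_left _ _
        linarith
      linarith
    rw [hz] at ht
    exact ht
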